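/- Let m ≥ 1. Suppose φ ∈ C¹(ℝᵐ) satisfies ‖φ‖_∞ ≤ 1 and Σ_{j=1}^m |∂φ/∂x_j (x)| ≤ 1 for every x ∈ ℝᵐ, and let b be a measurable function with ‖b‖_∞ ≤ 1. Then for every α with 0 < α < 1 and every open set Ω ⊂ ℝᵐ of finite Lebesgue measure, Σ_{Q dyadic cube, Q ⊂ Ω, |Q| ≤ α} ‖Δ_Q(φ b)‖_{L²}² ≤ 2·(‖b‖_{BMO,2}² + α^{2/m})·|Ω|. -/

import Mathlib

open MeasureTheory ENNReal Filter

noncomputable section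

/-- A dyadic cube in `ℝ^m`, recorded by its generation `k` and its corner index `j`;
it represents the set `∏ i, [j i * 2^k, (j i + 1) * 2^k)`. -/
structure DyadicCube (m : ℕ) where
  k : ℤ
  j : Fin m → ℤ

/-- The underlying set of a dyadic cube. -/
def dyadicCubeSet {m : ℕ} (c : DyadicCube m) : Set (Fin m → ℝ) :=
  {x | ∀ i, (c.j i : ℝ) * 2 ^ c.k ≤ x i ∧ x i < ((c.j i : ℝ) + 1) * 2 ^ c.k}

/-- The generation-`k` dyadic cube containing the point `x`. -/
def dyadicCubeOf {m : ℕ} (k : ℤ) (x : Fin m → ℝ) : DyadicCube m :=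
  ⟨k, fun i => ⌊x i / 2 ^ k⌋⟩

/-- `E_k f x`: the average of `f` over the generation-`k` dyadic cube containing `x`. -/
def Ek {m : ℕ} (k : ℤ) (f : (Fin m → ℝ) → ℝ) (x : Fin m → ℝ) : ℝ :=
  ⨍ y in dyadicCubeSet (dyadicCubeOf k x), f y

/-- The martingale difference operator `Δ_Q f = (E_{k-1} f - E_k f) · 1_Q`
for a dyadic cube `Q` of generation `k`. -/
def deltaQ {m : ℕ} (c : DyadicCube m) (f : (Fin m → ℝ) → ℝ) : (Fin m → ℝ) → ℝ :=
  (dyadicCubeSet c).indicator (fun y => Ek (c.k - 1) f y - Ek c.k f y)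

/-- The product space `ℝ^{n 0} × ⋯ × ℝ^{n (d-1)}`. -/
abbrev ProductSpace {d : ℕ} (n : Fin d → ℕ) : Type := ∀ i, (Fin (n i) → ℝ)

/-- A dyadic rectangle `R = Q₁ × ⋯ × Q_d`, one dyadic cube in each block. -/
abbrev DyadicRect {d : ℕ} (n : Fin d → ℕ) : Type := ∀ i, DyadicCube (n i)

/-- The underlying set of a dyadic rectangle. -/
def dyadicRectSet {d : ℕ} {n : Fin d → ℕ} (R : DyadicRect n) : Set (ProductSpace n) :=
  {x | ∀ i, x i ∈ dyadicCubeSet (R i)}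

/-- Apply the one-parameter operator `Δ_Q` in the `i`-th block of variables. -/
def deltaBlock {d : ℕ} {n : Fin d → ℕ} (i : Fin d) (c : DyadicCube (n i))
    (f : ProductSpace n → ℝ) (x : ProductSpace n) : ℝ :=
  deltaQ c (fun y => f (Function.update x i y)) (x i)

/-- The multiparameter difference operator `Δ_R = Δ_{Q₁} ⊗ ⋯ ⊗ Δ_{Q_d}`, obtained
by applying `Δ_{Q_i}` in the `i`-th block of variables. -/
def deltaR {d : ℕ} {n : Fin d → ℕ} (R : DyadicRect n) (f : ProductSpace n → ℝ) :
    ProductSpace n → ℝ :=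
  (List.finRange d).foldr (fun i g => deltaBlock i (R i) g) f

/-- The squared `L²` norm `‖g‖_{L²}²`, as an extended nonnegative real. -/
def l2normSq {d : ℕ} {n : Fin d → ℕ} (g : ProductSpace n → ℝ) : ℝ≥0∞ :=
  ∫⁻ x, ENNReal.ofReal (g x ^ 2)

/-- The multiparameter dyadic square function `S f (x) = (∑_R |Δ_R f(x)|²)^{1/2}`. -/
def squareFn {d : ℕ} {n : Fin d → ℕ} (f : ProductSpace n → ℝ) (x : ProductSpace n) : ℝ≥0∞ :=
  (∑' R : DyadicRect n, ENNReal.ofReal (deltaR R f x ^ 2)) ^ (1 / 2 : ℝ)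

/-- The dyadic product `H¹` norm `‖S f‖_{L¹}`. -/
def H1Norm {d : ℕ} {n : Fin d → ℕ} (f : ProductSpace n → ℝ) : ℝ≥0∞ :=
  ∫⁻ x, squareFn f x

/-- An axis-parallel cube in `ℝ^m` with arbitrary corner and (positive) side length. -/
structure Cube (m : ℕ) where
  corner : Fin m → ℝ
  side : ℝ
  side_pos : 0 < side

/-- The underlying set of a cube. -/
def cubeSet {m : ℕ} (c : Cube m) : Set (Fin m → ℝ) :=
  {x | ∀ i, c.corner i ≤ x i ∧ x i < c.corner i + c.side}

/-- A rectangle `R = Q₁ × ⋯ × Q_d`: an axis-parallel cube in each block. -/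
abbrev Rect {d : ℕ} (n : Fin d → ℕ) : Type := ∀ i, Cube (n i)

/-- The underlying set of a rectangle. -/
def rectSet {d : ℕ} {n : Fin d → ℕ} (R : Rect n) : Set (ProductSpace n) :=
  {x | ∀ i, x i ∈ cubeSet (R i)}

/-- The little `bmo` norm: `sup_R |R|⁻¹ ∫_R |f - f_R|` over all rectangles. -/
def bmo1 {d : ℕ} {n : Fin d → ℕ} (f : ProductSpace n → ℝ) : ℝ≥0∞ :=
  ⨆ R : Rect n,
    (volume (rectSet R))⁻¹ * ∫⁻ x in rectSet R, ENNReal.ofReal |f x - ⨍ y in rectSet R, f y|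

/-- The `L²`-based little `bmo` norm: `sup_R (|R|⁻¹ ∫_R |f - f_R|²)^{1/2}` over all
rectangles. -/
def bmo2 {d : ℕ} {n : Fin d → ℕ} (f : ProductSpace n → ℝ) : ℝ≥0∞ :=
  ⨆ R : Rect n,
    ((volume (rectSet R))⁻¹ *
      ∫⁻ x in rectSet R, ENNReal.ofReal ((f x - ⨍ y in rectSet R, f y) ^ 2)) ^ (1 / 2 : ℝ)

/-- The one-parameter `BMO` norm over all axis-parallel cubes in `ℝ^m`. -/
def bmo1Cube {m : ℕ} (g : (Fin m → ℝ) → ℝ) : ℝ≥0∞ :=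
  ⨆ Q : Cube m,
    (volume (cubeSet Q))⁻¹ * ∫⁻ x in cubeSet Q, ENNReal.ofReal |g x - ⨍ y in cubeSet Q, g y|

/-- The `L²`-based one-parameter `BMO` norm over all axis-parallel cubes in `ℝ^m`. -/
def bmo2Cube {m : ℕ} (g : (Fin m → ℝ) → ℝ) : ℝ≥0∞ :=
  ⨆ Q : Cube m,
    ((volume (cubeSet Q))⁻¹ *
      ∫⁻ x in cubeSet Q, ENNReal.ofReal ((g x - ⨍ y in cubeSet Q, g y) ^ 2)) ^ (1 / 2 : ℝ)

/-- The strong maximal function: supremum of averages of `|f|` over all rectangles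
containing the point. -/
def strongMaximal {d : ℕ} {n : Fin d → ℕ} (f : ProductSpace n → ℝ) (x : ProductSpace n) :
    ℝ≥0∞ :=
  ⨆ (R : Rect n) (_ : x ∈ rectSet R),
    (volume (rectSet R))⁻¹ * ∫⁻ y in rectSet R, ENNReal.ofReal |f y|

end

theorem mem_dyadicCubeSet_iff {m : ℕ} {c : DyadicCube m} {x : Fin m → ℝ} :
    x ∈ dyadicCubeSet c ↔ dyadicCubeOf c.k x = c := by
  obtain ⟨k, j⟩ := c
  have h2 : (0 : ℝ) < 2 ^ k := by positivity
  simp only [dyadicCubeSet, Set.mem_ofPred_eq, dyadicCubeOf, DyadicCube.mk.injEq, true_and,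
    funext_iff, Int.floor_eq_iff, le_div_iff₀ h2, div_lt_iff₀ h2]

theorem mem_dyadicCubeSet_dyadicCubeOf {m : ℕ} (k : ℤ) (x : Fin m → ℝ) :
    x ∈ dyadicCubeSet (dyadicCubeOf k x) :=
  mem_dyadicCubeSet_iff.2 rfl

theorem dyadicCubeOf_eq_of_sub_one {m : ℕ} {k : ℤ} {x y : Fin m → ℝ}
    (h : dyadicCubeOf (k - 1) x = dyadicCubeOf (k - 1) y) :
    dyadicCubeOf k x = dyadicCubeOf k y := by
  have key : ∀ t : ℝ, ⌊t / 2 ^ k⌋ = ⌊t / 2 ^ (k - 1)⌋ / 2 := by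
    intro t
    have : t / 2 ^ k = t / 2 ^ (k - 1) / (2 : ℕ) := by
      rw [zpow_sub_one₀ two_ne_zero]
      field_simp
      norm_num
    rw [this, Int.floor_div_natCast]
    norm_num
  simp only [dyadicCubeOf, DyadicCube.mk.injEq, true_and, funext_iff] at h ⊢
  intro i
  rw [key, key, h i]

theorem dyadicCubeSet_eq_pi {m : ℕ} (c : DyadicCube m) :
    dyadicCubeSet c = Set.univ.pi fun i =>
      Set.Ico ((c.j i : ℝ) * 2 ^ c.k) (((c.j i : ℝ) + 1) * 2 ^ c.k) := by
  ext x
  simp [dyadicCubeSet]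

theorem measurableSet_dyadicCubeSet {m : ℕ} (c : DyadicCube m) :
    MeasurableSet (dyadicCubeSet c) := by
  rw [dyadicCubeSet_eq_pi]
  exact MeasurableSet.univ_pi fun _ => measurableSet_Ico

theorem volume_dyadicCubeSet {m : ℕ} (c : DyadicCube m) :
    volume (dyadicCubeSet c) = ENNReal.ofReal (((2 : ℝ) ^ c.k) ^ m) := by
  rw [dyadicCubeSet_eq_pi, Real.volume_pi_Ico, ENNReal.ofReal_pow (by positivity)]
  simp [add_mul]

theorem volume_dyadicCubeSet_ne_zero {m : ℕ} (c : DyadicCube m) :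
    volume (dyadicCubeSet c) ≠ 0 := by
  rw [volume_dyadicCubeSet]
  simp only [ne_eq, ENNReal.ofReal_eq_zero, not_le]
  positivity

theorem volume_dyadicCubeSet_ne_top {m : ℕ} (c : DyadicCube m) :
    volume (dyadicCubeSet c) ≠ ⊤ := by
  rw [volume_dyadicCubeSet]
  exact ENNReal.ofReal_ne_top

theorem norm_sub_le_of_mem_dyadicCubeSet {m : ℕ} {c : DyadicCube m} {x y : Fin m → ℝ}
    (hx : x ∈ dyadicCubeSet c) (hy : y ∈ dyadicCubeSet c) : ‖x - y‖ ≤ 2 ^ c.k := by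
  refine (pi_norm_le_iff_of_nonneg (by positivity)).2 fun i => ?_
  have h1 := hx i
  have h2 := hy i
  rw [Pi.sub_apply, Real.norm_eq_abs, abs_le]
  constructor <;> linarith [h1.1, h1.2, h2.1, h2.2]

/-- A set is saturated for generation `k` if it is a union of dyadic cubes of generation `k`. -/
def DyadicSaturated {m : ℕ} (k : ℤ) (S : Set (Fin m → ℝ)) : Prop :=
  ∀ ⦃x y⦄, dyadicCubeOf k x = dyadicCubeOf k y → x ∈ S → y ∈ S

theorem DyadicSaturated.sub_one {m : ℕ} {k : ℤ} {S : Set (Fin m → ℝ)}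
    (hS : DyadicSaturated k S) : DyadicSaturated (k - 1) S :=
  fun _ _ h => hS (dyadicCubeOf_eq_of_sub_one h)

theorem DyadicSaturated.diff {m : ℕ} {k : ℤ} {S T : Set (Fin m → ℝ)}
    (hS : DyadicSaturated k S) (hT : DyadicSaturated k T) : DyadicSaturated k (S \ T) :=
  fun _ _ h hx => ⟨hS h hx.1, fun hy => hx.2 (hT h.symm hy)⟩

theorem DyadicSaturated.eq_iUnion {m : ℕ} {k : ℤ} {S : Set (Fin m → ℝ)}
    (hS : DyadicSaturated k S) :
    S = ⋃ j : {j : Fin m → ℤ // dyadicCubeSet ⟨k, j⟩ ⊆ S}, dyadicCubeSet ⟨k, j.1⟩ := by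
  ext x
  simp only [Set.mem_iUnion]
  constructor
  · intro hx
    refine ⟨⟨(dyadicCubeOf k x).j, fun y hy => ?_⟩, mem_dyadicCubeSet_dyadicCubeOf k x⟩
    exact hS (mem_dyadicCubeSet_iff.1 hy).symm hx
  · rintro ⟨j, hj⟩
    exact j.2 hj

theorem DyadicSaturated.measurableSet {m : ℕ} {k : ℤ} {S : Set (Fin m → ℝ)}
    (hS : DyadicSaturated k S) : MeasurableSet S := by
  rw [hS.eq_iUnion]
  exact MeasurableSet.iUnion fun _ => measurableSet_dyadicCubeSet _

theorem DyadicSaturated.lintegral_eq_tsum {m : ℕ} {k : ℤ} {S : Set (Fin m → ℝ)}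
    (hS : DyadicSaturated k S) (F : (Fin m → ℝ) → ℝ≥0∞) :
    ∫⁻ x in S, F x =
      ∑' j : {j : Fin m → ℤ // dyadicCubeSet ⟨k, j⟩ ⊆ S}, ∫⁻ x in dyadicCubeSet ⟨k, j.1⟩, F x := by
  conv_lhs => rw [hS.eq_iUnion]
  refine lintegral_iUnion (fun _ => measurableSet_dyadicCubeSet _) ?_ F
  intro i j hij
  refine Set.disjoint_left.2 fun x hi hj => hij (Subtype.ext ?_)
  have hi' : dyadicCubeOf k x = ⟨k, i⟩ := mem_dyadicCubeSet_iff.1 hi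
  have hj' : dyadicCubeOf k x = ⟨k, j⟩ := mem_dyadicCubeSet_iff.1 hj
  exact congrArg DyadicCube.j (hi'.symm.trans hj')

/-- The union of the dyadic cubes of generation `k` contained in `Ω`. -/
def dyadicInterior {m : ℕ} (k : ℤ) (Ω : Set (Fin m → ℝ)) : Set (Fin m → ℝ) :=
  {x | dyadicCubeSet (dyadicCubeOf k x) ⊆ Ω}

theorem dyadicSaturated_dyadicInterior {m : ℕ} (k : ℤ) (Ω : Set (Fin m → ℝ)) :
    DyadicSaturated k (dyadicInterior k Ω) := by
  intro x y h hx
  simpa only [dyadicInterior, Set.mem_ofPred_eq, h] using hx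

theorem dyadicInterior_subset {m : ℕ} (k : ℤ) (Ω : Set (Fin m → ℝ)) :
    dyadicInterior k Ω ⊆ Ω :=
  fun x hx => hx (mem_dyadicCubeSet_dyadicCubeOf k x)

theorem dyadicInterior_subset_sub_one {m : ℕ} (k : ℤ) (Ω : Set (Fin m → ℝ)) :
    dyadicInterior k Ω ⊆ dyadicInterior (k - 1) Ω := by
  intro x hx y hy
  refine hx (mem_dyadicCubeSet_iff.2 ?_)
  exact dyadicCubeOf_eq_of_sub_one (mem_dyadicCubeSet_iff.1 hy)

theorem dyadicCubeSet_subset_dyadicInterior_iff {m : ℕ} {c : DyadicCube m}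
    {Ω : Set (Fin m → ℝ)} :
    dyadicCubeSet c ⊆ dyadicInterior c.k Ω ↔ dyadicCubeSet c ⊆ Ω := by
  refine ⟨fun h => h.trans (dyadicInterior_subset _ _), fun h x hx => ?_⟩
  rwa [dyadicInterior, Set.mem_ofPred_eq, mem_dyadicCubeSet_iff.1 hx]

theorem Ek_eq_setAverage {m : ℕ} {c : DyadicCube m} {x : Fin m → ℝ}
    (hx : x ∈ dyadicCubeSet c) (f : (Fin m → ℝ) → ℝ) :
    Ek c.k f x = ⨍ y in dyadicCubeSet c, f y := by
  rw [Ek, mem_dyadicCubeSet_iff.1 hx]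

theorem lintegral_deltaQ_sq {m : ℕ} (c : DyadicCube m) (f : (Fin m → ℝ) → ℝ) :
    ∫⁻ x, ENNReal.ofReal (deltaQ c f x ^ 2) =
      ∫⁻ x in dyadicCubeSet c, ENNReal.ofReal ((Ek (c.k - 1) f x - Ek c.k f x) ^ 2) := by
  rw [← lintegral_indicator (measurableSet_dyadicCubeSet c)]
  congr 1 with x
  by_cases hx : x ∈ dyadicCubeSet c <;> simp [deltaQ, hx]

/-- The variance identity: the mean square deviation from a constant splits as the deviation of
the average plus the deviation from the average. -/
theorem lintegral_sq_sub_const_eq {X : Type*} [MeasurableSpace X] {μ : Measure X}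
    [IsFiniteMeasure μ] [NeZero μ] {f : X → ℝ} (hf : MemLp f 2 μ) (c : ℝ) :
    ∫⁻ x, ENNReal.ofReal ((f x - c) ^ 2) ∂μ =
      (∫⁻ _, ENNReal.ofReal (((⨍ y, f y ∂μ) - c) ^ 2) ∂μ) +
        ∫⁻ x, ENNReal.ofReal ((f x - ⨍ y, f y ∂μ) ^ 2) ∂μ := by
  set a := ⨍ y, f y ∂μ with ha
  have hfi : Integrable f μ := hf.integrable (by norm_num)
  have hsq : ∀ d : ℝ, Integrable (fun x => (f x - d) ^ 2) μ := fun d =>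
    (hf.sub (memLp_const d)).integrable_sq
  have hmean : ∫ x, (f x - a) ∂μ = 0 := integral_sub_average μ f
  have hlin : Integrable (fun x => f x - a) μ := hfi.sub (integrable_const a)
  rw [← ofReal_integral_eq_lintegral_ofReal (hsq c) (ae_of_all _ fun _ => sq_nonneg _),
    ← ofReal_integral_eq_lintegral_ofReal (hsq a) (ae_of_all _ fun _ => sq_nonneg _),
    ← ofReal_integral_eq_lintegral_ofReal (integrable_const _) (ae_of_all _ fun _ => sq_nonneg _),
    ← ENNReal.ofReal_add (integral_nonneg fun _ => sq_nonneg _)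
      (integral_nonneg fun _ => sq_nonneg _)]
  congr 1
  have hexp : ∀ x, (f x - c) ^ 2 = ((a - c) ^ 2 + (f x - a) ^ 2) + 2 * (a - c) * (f x - a) :=
    fun x => by ring
  have hconst : Integrable (fun _ : X => (a - c) ^ 2) μ := integrable_const _
  have hadd : Integrable (fun x => (a - c) ^ 2 + (f x - a) ^ 2) μ := hconst.add (hsq a)
  simp_rw [hexp]
  rw [integral_add hadd (hlin.const_mul _), integral_add hconst (hsq a), integral_const_mul,
    hmean, mul_zero, add_zero]

theorem neZero_restrict_dyadicCubeSet {m : ℕ} (c : DyadicCube m) :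
    NeZero ((volume : Measure (Fin m → ℝ)).restrict (dyadicCubeSet c)) :=
  ⟨fun h => volume_dyadicCubeSet_ne_zero c (Measure.restrict_eq_zero.1 h)⟩

theorem isFiniteMeasure_restrict_dyadicCubeSet {m : ℕ} (c : DyadicCube m) :
    IsFiniteMeasure ((volume : Measure (Fin m → ℝ)).restrict (dyadicCubeSet c)) :=
  isFiniteMeasure_restrict.2 (volume_dyadicCubeSet_ne_top c)

theorem memLp_two_restrict_dyadicCubeSet {m : ℕ} {f : (Fin m → ℝ) → ℝ}
    (hf : AEStronglyMeasurable f volume) (hf1 : ∀ᵐ x, |f x| ≤ 1) (c : DyadicCube m) :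
    MemLp f 2 (volume.restrict (dyadicCubeSet c)) :=
  have := isFiniteMeasure_restrict_dyadicCubeSet c
  MemLp.of_bound hf.restrict 1 (ae_restrict_of_ae hf1)

/-- Orthogonality of one martingale difference to the remaining martingale tail. -/
theorem lintegral_sq_sub_Ek_eq {m : ℕ} {f : (Fin m → ℝ) → ℝ}
    (hf : ∀ c : DyadicCube m, MemLp f 2 (volume.restrict (dyadicCubeSet c)))
    {k : ℤ} {S : Set (Fin m → ℝ)} (hS : DyadicSaturated (k - 1) S) :
    ∫⁻ x in S, ENNReal.ofReal ((f x - Ek k f x) ^ 2) =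
      (∫⁻ x in S, ENNReal.ofReal ((Ek (k - 1) f x - Ek k f x) ^ 2)) +
        ∫⁻ x in S, ENNReal.ofReal ((f x - Ek (k - 1) f x) ^ 2) := by
  rw [hS.lintegral_eq_tsum, hS.lintegral_eq_tsum, hS.lintegral_eq_tsum, ← ENNReal.tsum_add]
  refine tsum_congr fun ⟨j, _⟩ => ?_
  set c : DyadicCube m := ⟨k - 1, j⟩
  have hne := neZero_restrict_dyadicCubeSet c
  have hfin := isFiniteMeasure_restrict_dyadicCubeSet c
  have hmeas := measurableSet_dyadicCubeSet c
  obtain ⟨x₀, hx₀⟩ : (dyadicCubeSet c).Nonempty :=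
    nonempty_of_measure_ne_zero (volume_dyadicCubeSet_ne_zero c)
  have hk : ∀ x ∈ dyadicCubeSet c, Ek k f x = Ek k f x₀ := fun x hx => by
    rw [Ek, Ek, dyadicCubeOf_eq_of_sub_one
      ((mem_dyadicCubeSet_iff.1 hx).trans (mem_dyadicCubeSet_iff.1 hx₀).symm)]
  have hk1 : ∀ x ∈ dyadicCubeSet c, Ek (k - 1) f x = ⨍ y in dyadicCubeSet c, f y :=
    fun x hx => Ek_eq_setAverage hx f
  have h := lintegral_sq_sub_const_eq (hf c) (Ek k f x₀)
  convert h using 1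
  · exact setLIntegral_congr_fun hmeas fun x hx => by simp only [hk x hx]
  · congr 1
    · exact setLIntegral_congr_fun hmeas fun x hx => by simp only [hk x hx, hk1 x hx]
    · exact setLIntegral_congr_fun hmeas fun x hx => by simp only [hk1 x hx]

theorem lintegral_sq_sub_Ek_le {m : ℕ} {f : (Fin m → ℝ) → ℝ} {C : ℝ≥0∞} {k : ℤ}
    (hC : ∀ c : DyadicCube m, c.k = k →
      ∫⁻ x in dyadicCubeSet c, ENNReal.ofReal ((f x - ⨍ y in dyadicCubeSet c, f y) ^ 2) ≤
        C * volume (dyadicCubeSet c))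
    {S : Set (Fin m → ℝ)} (hS : DyadicSaturated k S) :
    ∫⁻ x in S, ENNReal.ofReal ((f x - Ek k f x) ^ 2) ≤ C * volume S := by
  rw [hS.lintegral_eq_tsum, ← setLIntegral_one S, hS.lintegral_eq_tsum, ← ENNReal.tsum_mul_left]
  refine ENNReal.tsum_le_tsum fun ⟨j, _⟩ => ?_
  rw [setLIntegral_one]
  refine le_trans (le_of_eq ?_) (hC ⟨k, j⟩ rfl)
  exact setLIntegral_congr_fun (measurableSet_dyadicCubeSet _) fun x hx => by
    simp only [← Ek_eq_setAverage hx f]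

/-- The square function packing bound for the first `n` generations below `K`, with the
remaining martingale tail kept on the left-hand side. -/
theorem sum_lintegral_martingaleDiff_add_tail_le {m : ℕ} {f : (Fin m → ℝ) → ℝ}
    (hf : ∀ c : DyadicCube m, MemLp f 2 (volume.restrict (dyadicCubeSet c))) {C : ℝ≥0∞} {K : ℤ}
    (hC : ∀ c : DyadicCube m, c.k ≤ K →
      ∫⁻ x in dyadicCubeSet c, ENNReal.ofReal ((f x - ⨍ y in dyadicCubeSet c, f y) ^ 2) ≤
        C * volume (dyadicCubeSet c))
    (Ω : Set (Fin m → ℝ)) (n : ℕ) :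
    (∑ i ∈ Finset.range n, ∫⁻ x in dyadicInterior (K - i) Ω,
        ENNReal.ofReal ((Ek (K - i - 1) f x - Ek (K - i) f x) ^ 2)) +
      ∫⁻ x in dyadicInterior (K - n) Ω, ENNReal.ofReal ((f x - Ek (K - n) f x) ^ 2) ≤
        C * volume (dyadicInterior (K - n) Ω) := by
  induction n with
  | zero =>
    simp only [Finset.range_zero, Finset.sum_empty, zero_add]
    exact lintegral_sq_sub_Ek_le (fun c hc => hC c (by rw [hc]; simp))
      (dyadicSaturated_dyadicInterior _ _)
  | succ n ih =>
    have hcast : K - ((n + 1 : ℕ) : ℤ) = K - n - 1 := by push_cast; ring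
    rw [hcast, Finset.sum_range_succ]
    set k := K - (n : ℤ) with hk
    have hS := dyadicSaturated_dyadicInterior k Ω
    have hT := dyadicSaturated_dyadicInterior (k - 1) Ω
    have hsub := dyadicInterior_subset_sub_one k Ω
    rw [lintegral_sq_sub_Ek_eq hf hS.sub_one] at ih
    have hnew := lintegral_sq_sub_Ek_le (fun c hc => hC c (by omega)) (hT.diff hS.sub_one)
    have hsplit := lintegral_inter_add_sdiff (μ := volume)
      (fun x => ENNReal.ofReal ((f x - Ek (k - 1) f x) ^ 2))
      (dyadicInterior (k - 1) Ω) hS.measurableSet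
    have hvol := measure_inter_add_sdiff (μ := volume) (dyadicInterior (k - 1) Ω) hS.measurableSet
    rw [Set.inter_eq_right.2 hsub] at hsplit hvol
    rw [← hsplit, ← hvol, mul_add]
    simp only [← add_assoc] at ih ⊢
    exact add_le_add ih hnew

theorem abs_sub_le_norm_sub_of_sum_abs_partial_le {m : ℕ} {φ : (Fin m → ℝ) → ℝ}
    (hφ : Differentiable ℝ φ)
    (hφgrad : ∀ x, ∑ j, |fderiv ℝ φ x (Pi.single j (1 : ℝ))| ≤ 1) (x y : Fin m → ℝ) :
    |φ x - φ y| ≤ ‖x - y‖ := by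
  have hbound : ∀ z, ‖fderiv ℝ φ z‖ ≤ 1 := by
    refine fun z => ContinuousLinearMap.opNorm_le_bound _ zero_le_one fun v => ?_
    have hv : fderiv ℝ φ z v = ∑ j, v j * fderiv ℝ φ z (Pi.single j 1) := by
      conv_lhs => rw [pi_eq_sum_univ' v]
      simp only [map_sum, map_smul, smul_eq_mul]
    rw [hv, one_mul]
    calc ‖∑ j, v j * fderiv ℝ φ z (Pi.single j 1)‖
        ≤ ∑ j, ‖v‖ * |fderiv ℝ φ z (Pi.single j 1)| := by
          refine (norm_sum_le _ _).trans (Finset.sum_le_sum fun j _ => ?_)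
          rw [norm_mul, Real.norm_eq_abs (fderiv ℝ φ z _)]
          exact mul_le_mul_of_nonneg_right (norm_le_pi_norm v j) (abs_nonneg _)
      _ ≤ ‖v‖ := by
          rw [← Finset.mul_sum]
          exact mul_le_of_le_one_right (norm_nonneg _) (hφgrad z)
  have := convex_univ.norm_image_sub_le_of_norm_fderiv_le (𝕜 := ℝ) (f := φ)
    (fun z _ => hφ z) (fun z _ => hbound z) (Set.mem_univ y) (Set.mem_univ x)
  simpa using this

theorem lintegral_sq_sub_average_le_bmo2Cube {m : ℕ} (b : (Fin m → ℝ) → ℝ) (c : DyadicCube m) :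
    ∫⁻ x in dyadicCubeSet c, ENNReal.ofReal ((b x - ⨍ y in dyadicCubeSet c, b y) ^ 2) ≤
      bmo2Cube b ^ 2 * volume (dyadicCubeSet c) := by
  have hset : cubeSet (⟨fun i => (c.j i : ℝ) * 2 ^ c.k, 2 ^ c.k, by positivity⟩ : Cube m) =
      dyadicCubeSet c := by
    ext x
    simp only [cubeSet, dyadicCubeSet, Set.mem_ofPred_eq, add_mul, one_mul]
  have h := le_iSup (fun Q : Cube m => ((volume (cubeSet Q))⁻¹ *
    ∫⁻ x in cubeSet Q, ENNReal.ofReal ((b x - ⨍ y in cubeSet Q, b y) ^ 2)) ^ (1 / 2 : ℝ))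
    ⟨fun i => (c.j i : ℝ) * 2 ^ c.k, 2 ^ c.k, by positivity⟩
  simp only [hset] at h
  have h2 := pow_le_pow_left' h 2
  rw [← ENNReal.rpow_natCast, ← ENNReal.rpow_mul] at h2
  norm_num at h2
  rw [mul_comm, ← div_eq_mul_inv,
    ENNReal.div_le_iff (volume_dyadicCubeSet_ne_zero c) (volume_dyadicCubeSet_ne_top c)] at h2
  exact h2

theorem lintegral_sq_mul_sub_average_le {m : ℕ} {φ b : (Fin m → ℝ) → ℝ}
    (hφ : Differentiable ℝ φ) (hφ1 : ∀ x, |φ x| ≤ 1)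
    (hφgrad : ∀ x, ∑ j, |fderiv ℝ φ x (Pi.single j (1 : ℝ))| ≤ 1)
    (hb1 : ∀ᵐ x, |b x| ≤ 1) (c : DyadicCube m)
    (hf : MemLp (fun x => φ x * b x) 2 (volume.restrict (dyadicCubeSet c))) :
    ∫⁻ x in dyadicCubeSet c,
        ENNReal.ofReal ((φ x * b x - ⨍ y in dyadicCubeSet c, φ y * b y) ^ 2) ≤
      2 * (bmo2Cube b ^ 2 + ENNReal.ofReal ((2 ^ c.k) ^ 2)) * volume (dyadicCubeSet c) := by
  have hne := neZero_restrict_dyadicCubeSet c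
  have hfin := isFiniteMeasure_restrict_dyadicCubeSet c
  have hmeas := measurableSet_dyadicCubeSet c
  obtain ⟨x₀, hx₀⟩ : (dyadicCubeSet c).Nonempty :=
    nonempty_of_measure_ne_zero (volume_dyadicCubeSet_ne_zero c)
  set a := ⨍ y in dyadicCubeSet c, b y with ha
  have ha1 : |a| ≤ 1 := by
    have h := norm_integral_le_of_norm_le_const
      (μ := volume.restrict (dyadicCubeSet c)) (f := b) (C := 1) (ae_restrict_of_ae hb1)
    have hpos : 0 < (volume.restrict (dyadicCubeSet c)).real Set.univ := measureReal_univ_pos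
    rw [ha, average_eq, smul_eq_mul, abs_mul, abs_of_pos (inv_pos.2 hpos),
      inv_mul_le_iff₀ hpos]
    simpa [mul_comm] using h
  have hpt : ∀ x ∈ dyadicCubeSet c, ENNReal.ofReal ((φ x * b x - φ x₀ * a) ^ 2) ≤
      2 * ENNReal.ofReal ((b x - a) ^ 2) + 2 * ENNReal.ofReal ((2 ^ c.k) ^ 2) := by
    intro x hx
    have hL : |φ x - φ x₀| ≤ 2 ^ c.k :=
      (abs_sub_le_norm_sub_of_sum_abs_partial_le hφ hφgrad x x₀).trans
        (norm_sub_le_of_mem_dyadicCubeSet hx hx₀)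
    have h1 : (φ x * (b x - a)) ^ 2 ≤ (b x - a) ^ 2 := by
      rw [mul_pow]
      exact mul_le_of_le_one_left (sq_nonneg _) ((sq_le_one_iff_abs_le_one _).2 (hφ1 x))
    have h2 : ((φ x - φ x₀) * a) ^ 2 ≤ (2 ^ c.k) ^ 2 := by
      rw [mul_pow]
      refine (mul_le_of_le_one_right (sq_nonneg _) ((sq_le_one_iff_abs_le_one _).2 ha1)).trans ?_
      rw [← sq_abs]
      exact pow_le_pow_left₀ (abs_nonneg _) hL 2
    rw [← mul_add, ← ENNReal.ofReal_add (sq_nonneg _) (sq_nonneg _),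
      show (2 : ℝ≥0∞) = ENNReal.ofReal 2 by simp, ← ENNReal.ofReal_mul zero_le_two]
    refine ENNReal.ofReal_le_ofReal ?_
    have h3 := add_sq_le (a := φ x * (b x - a)) (b := (φ x - φ x₀) * a)
    have h4 : φ x * b x - φ x₀ * a = φ x * (b x - a) + (φ x - φ x₀) * a := by ring
    rw [h4]
    linarith
  calc ∫⁻ x in dyadicCubeSet c,
        ENNReal.ofReal ((φ x * b x - ⨍ y in dyadicCubeSet c, φ y * b y) ^ 2)
      ≤ ∫⁻ x in dyadicCubeSet c, ENNReal.ofReal ((φ x * b x - φ x₀ * a) ^ 2) := by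
        rw [lintegral_sq_sub_const_eq hf (φ x₀ * a)]
        exact le_add_self
    _ ≤ ∫⁻ x in dyadicCubeSet c,
          (2 * ENNReal.ofReal ((b x - a) ^ 2) + 2 * ENNReal.ofReal ((2 ^ c.k) ^ 2)) :=
        setLIntegral_mono' hmeas hpt
    _ = 2 * (∫⁻ x in dyadicCubeSet c, ENNReal.ofReal ((b x - a) ^ 2)) +
          2 * ENNReal.ofReal ((2 ^ c.k) ^ 2) * volume (dyadicCubeSet c) := by
        rw [lintegral_add_right _ measurable_const, setLIntegral_const,
          lintegral_const_mul' _ _ ENNReal.ofNat_ne_top]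
    _ ≤ 2 * (bmo2Cube b ^ 2 * volume (dyadicCubeSet c)) +
          2 * ENNReal.ofReal ((2 ^ c.k) ^ 2) * volume (dyadicCubeSet c) := by
        gcongr
        exact lintegral_sq_sub_average_le_bmo2Cube b c
    _ = _ := by ring

/-- If the oscillation of `f` over every dyadic cube of volume at most `α` is controlled, then
the martingale differences over such cubes inside `Ω` satisfy a packing bound. -/
theorem tsum_lintegral_deltaQ_sq_le {m : ℕ} {f : (Fin m → ℝ) → ℝ}
    (hf : ∀ c : DyadicCube m, MemLp f 2 (volume.restrict (dyadicCubeSet c))) {C α : ℝ≥0∞}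
    (hC : ∀ c : DyadicCube m, volume (dyadicCubeSet c) ≤ α →
      ∫⁻ x in dyadicCubeSet c, ENNReal.ofReal ((f x - ⨍ y in dyadicCubeSet c, f y) ^ 2) ≤
        C * volume (dyadicCubeSet c))
    (Ω : Set (Fin m → ℝ)) :
    ∑' Q : {Q : DyadicCube m // dyadicCubeSet Q ⊆ Ω ∧ volume (dyadicCubeSet Q) ≤ α},
      ∫⁻ x, ENNReal.ofReal (deltaQ Q.1 f x ^ 2) ≤ C * volume Ω := by
  set D : ℤ → ℝ≥0∞ := fun k => ∫⁻ x in dyadicInterior k Ω,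
    ENNReal.ofReal ((Ek (k - 1) f x - Ek k f x) ^ 2) with hD
  set A : Set ℤ := {k | ENNReal.ofReal (((2 : ℝ) ^ k) ^ m) ≤ α} with hA
  let e : (Σ k : A, {j : Fin m → ℤ // dyadicCubeSet ⟨k, j⟩ ⊆ dyadicInterior k.1 Ω}) ≃
      {Q : DyadicCube m // dyadicCubeSet Q ⊆ Ω ∧ volume (dyadicCubeSet Q) ≤ α} :=
    { toFun := fun p => ⟨⟨p.1, p.2.1⟩,
        (dyadicCubeSet_subset_dyadicInterior_iff (c := ⟨_, _⟩)).1 p.2.2,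
        (volume_dyadicCubeSet _).le.trans p.1.2⟩
      invFun := fun Q => ⟨⟨Q.1.k, (volume_dyadicCubeSet _).ge.trans Q.2.2⟩,
        ⟨Q.1.j, dyadicCubeSet_subset_dyadicInterior_iff.2 Q.2.1⟩⟩
      left_inv := fun _ => rfl
      right_inv := fun _ => rfl }
  have hsum : ∑' Q : {Q : DyadicCube m // dyadicCubeSet Q ⊆ Ω ∧ volume (dyadicCubeSet Q) ≤ α},
      ∫⁻ x, ENNReal.ofReal (deltaQ Q.1 f x ^ 2) = ∑' k : A, D k := by
    rw [← e.tsum_eq, ENNReal.tsum_sigma']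
    refine tsum_congr fun k => ?_
    simp only [hD]
    rw [(dyadicSaturated_dyadicInterior k.1 Ω).lintegral_eq_tsum]
    exact tsum_congr fun j => lintegral_deltaQ_sq ⟨k.1, j.1⟩ f
  rw [hsum, ENNReal.tsum_eq_iSup_sum]
  refine iSup_le fun s => ?_
  rcases s.eq_empty_or_nonempty with rfl | hs
  · simp
  obtain ⟨K, hKs, hK⟩ := s.exists_max_image id hs
  obtain ⟨L, hLs, hL⟩ := s.exists_min_image id hs
  have hCK : ∀ c : DyadicCube m, c.k ≤ K.1 → volume (dyadicCubeSet c) ≤ α := by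
    intro c hc
    rw [volume_dyadicCubeSet]
    refine le_trans (ENNReal.ofReal_le_ofReal ?_) K.2
    exact pow_le_pow_left₀ (by positivity) (zpow_le_zpow_right₀ one_le_two hc) m
  have hmain := sum_lintegral_martingaleDiff_add_tail_le hf (fun c hc => hC c (hCK c hc)) Ω
    ((K.1 - L.1).toNat + 1)
  calc ∑ k ∈ s, D k = ∑ i ∈ s.image (fun k => (K.1 - k.1).toNat), D (K.1 - i) := by
        rw [Finset.sum_image]
        · refine Finset.sum_congr rfl fun k hk => ?_
          have h1 : k.1 ≤ K.1 := hK k hk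
          rw [Int.toNat_of_nonneg (by omega), _root_.sub_sub_cancel]
        · intro k hk l hl hkl
          have h1 : k.1 ≤ K.1 := hK k hk
          have h2 : l.1 ≤ K.1 := hK l hl
          simp only at hkl
          exact Subtype.ext (by omega)
    _ ≤ ∑ i ∈ Finset.range ((K.1 - L.1).toNat + 1), D (K.1 - i) := by
        refine Finset.sum_le_sum_of_subset fun i hi => ?_
        obtain ⟨k, hk, rfl⟩ := Finset.mem_image.1 hi
        have h1 : L.1 ≤ k.1 := hL k hk
        rw [Finset.mem_range]
        omega
    _ ≤ C * volume (dyadicInterior (K.1 - ((K.1 - L.1).toNat + 1 : ℕ)) Ω) :=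
        le_self_add.trans hmain
    _ ≤ C * volume Ω := by
        gcongr
        exact dyadicInterior_subset _ _

/-- Lemma B, one-parameter case: if `φ ∈ C¹(ℝᵐ)` with `‖φ‖_∞ ≤ 1` and
`∑_j |∂φ/∂x_j| ≤ 1` pointwise, and `‖b‖_∞ ≤ 1`, then for every `0 < α < 1` and open
`Ω ⊆ ℝᵐ` of finite measure,
`∑_{Q ⊆ Ω, |Q| ≤ α} ‖Δ_Q(φb)‖₂² ≤ 2·(‖b‖_{BMO,2}² + α^{2/m})·|Ω|`. -/
theorem statement3 (m : ℕ) (hm : 1 ≤ m) (φ b : (Fin m → ℝ) → ℝ)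
    (hφ : ContDiff ℝ 1 φ) (hφ1 : ∀ x, |φ x| ≤ 1)
    (hφgrad : ∀ x, ∑ j, |fderiv ℝ φ x (Pi.single j (1 : ℝ))| ≤ 1)
    (hb : Measurable b) (hb1 : ∀ᵐ x ∂(volume : Measure (Fin m → ℝ)), |b x| ≤ 1)
    (α : ℝ) (hα0 : 0 < α) (hα1 : α < 1)
    (Ω : Set (Fin m → ℝ)) (hΩ : IsOpen Ω) (hΩfin : volume Ω < ⊤) :
    ∑' Q : {Q : DyadicCube m //
        dyadicCubeSet Q ⊆ Ω ∧ volume (dyadicCubeSet Q) ≤ ENNReal.ofReal α},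
      ∫⁻ x, ENNReal.ofReal (deltaQ Q.1 (fun y => φ y * b y) x ^ 2)
      ≤ 2 * (bmo2Cube b ^ 2 + ENNReal.ofReal (α ^ ((2 : ℝ) / (m : ℝ)))) * volume Ω := by
  have hf : ∀ c : DyadicCube m,
      MemLp (fun x => φ x * b x) 2 (volume.restrict (dyadicCubeSet c)) := by
    refine memLp_two_restrict_dyadicCubeSet
      (hφ.continuous.aestronglyMeasurable.mul hb.aestronglyMeasurable) ?_
    filter_upwards [hb1] with x hx
    rw [abs_mul]
    exact mul_le_one₀ (hφ1 x) (abs_nonneg _) hx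
  refine tsum_lintegral_deltaQ_sq_le hf (fun c hc => ?_) Ω
  refine (lintegral_sq_mul_sub_average_le (hφ.differentiable one_ne_zero) hφ1 hφgrad
    hb1 c (hf c)).trans ?_
  gcongr
  rw [volume_dyadicCubeSet, ENNReal.ofReal_le_ofReal_iff hα0.le] at hc
  have hm0 : (m : ℝ) ≠ 0 := by
    have : m ≠ 0 := by omega
    exact_mod_cast this
  calc ((2 : ℝ) ^ c.k) ^ 2 = (((2 : ℝ) ^ c.k) ^ m) ^ ((2 : ℝ) / m) := by
        rw [← Real.rpow_natCast _ m, ← Real.rpow_mul (by positivity), mul_div_cancel₀ _ hm0,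
          Real.rpow_two]
    _ ≤ α ^ ((2 : ℝ) / m) := Real.rpow_le_rpow (by positivity) hc (by positivity)
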